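/- Let c be a real number with 1 < c < 4109054/1999527 and c ≠ 2, let ε > 0 be fixed and sufficiently small, let X be sufficiently large, and set H = X^{38687/2666036}. Then Σ_{X < n ≤ 2X} min(1, 1/(H·‖n^c‖)) ≪ X^{2627349/2666036}·log X, with implied constant depending only on c. -/

import Mathlib

open scoped Classical
open Finset Real

/-- `mfun H θ = min(1, 1/(H‖θ‖))`, where `‖θ‖ = |θ - round θ|` is the distance from `θ`
to the nearest integer, with the convention that the value is `1` when `‖θ‖ = 0`. -/
noncomputable def mfun (H θ : ℝ) : ℝ :=
  if |θ - round θ| = 0 then 1 else min 1 (1 / (H * |θ - round θ|))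

open scoped ComplexConjugate

/-- The additive character `x ↦ exp (2πix)`. -/
noncomputable def phase (x : ℝ) : ℂ := Complex.exp (Complex.I * ((2 * π * x : ℝ) : ℂ))

lemma norm_phase (x : ℝ) : ‖phase x‖ = 1 := Complex.norm_exp_I_mul_ofReal _

lemma phase_add (x y : ℝ) : phase (x + y) = phase x * phase y := by
  rw [phase, phase, phase, ← Complex.exp_add]
  push_cast
  ring_nf

lemma phase_mul_conj (x y : ℝ) : phase x * conj (phase y) = phase (x - y) := by
  rw [phase, phase, phase, ← Complex.exp_conj, ← Complex.exp_add]
  simp only [map_mul, Complex.conj_I, Complex.conj_ofReal]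
  push_cast
  ring_nf

lemma phase_re (x : ℝ) : (phase x).re = cos (2 * π * x) := by
  rw [phase, mul_comm, Complex.exp_ofReal_mul_I_re]

lemma norm_phase_sub_phase_le (x y : ℝ) : ‖phase x - phase y‖ ≤ 2 * π * |x - y| := by
  have h : phase x - phase y = phase y * (phase (x - y) - 1) := by
    rw [mul_sub, ← phase_add, add_sub_cancel, mul_one]
  rw [h, norm_mul, norm_phase, one_mul]
  refine (Real.norm_exp_I_mul_ofReal_sub_one_le).trans ?_
  rw [Real.norm_eq_abs, abs_mul, abs_of_pos Real.two_pi_pos]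

lemma four_mul_abs_le_norm_phase_sub_one {x : ℝ} (hx : |x| ≤ 1 / 2) :
    4 * |x| ≤ ‖phase x - 1‖ := by
  rw [phase, Complex.norm_exp_I_mul_ofReal_sub_one, norm_mul, Real.norm_eq_abs, Real.norm_eq_abs,
    abs_two, show 2 * π * x / 2 = π * x by ring]
  have hs : |sin (π * x)| = |sin (π * |x|)| := by
    rcases abs_cases x with ⟨h, _⟩ | ⟨h, _⟩ <;> rw [h]
    rw [mul_neg, sin_neg, abs_neg]
  have h := Real.mul_le_sin (x := π * |x|) (by positivity) (by nlinarith [pi_pos])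
  have h' : 2 / π * (π * |x|) = 2 * |x| := by
    field_simp
  rw [hs]
  linarith [le_abs_self (sin (π * |x|))]

/-- A version of the Kusmin–Landau inequality in which monotonicity of the increments of the
phase is replaced by a bound on its second differences. -/
lemma norm_sum_phase_le {φ : ℕ → ℝ} {a b : ℕ} (hab : a ≤ b) {θ η : ℝ} (hθ : 0 < θ)
    (hlow : ∀ n, a ≤ n → n ≤ b → θ ≤ |φ (n + 1) - φ n|)
    (hup : ∀ n, a ≤ n → n ≤ b → |φ (n + 1) - φ n| ≤ 1 / 2)
    (hsec : ∀ n, a ≤ n → n ≤ b → |(φ (n + 2) - φ (n + 1)) - (φ (n + 1) - φ n)| ≤ η) :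
    ‖∑ n ∈ Ioc a b, phase (φ n)‖ ≤ 1 / θ + ((b : ℝ) - a) * (η / θ ^ 2) := by
  set w : ℕ → ℂ := fun n => (phase (φ (n + 1) - φ n) - 1)⁻¹ with hw
  have hge : ∀ n, a ≤ n → n ≤ b → 4 * θ ≤ ‖phase (φ (n + 1) - φ n) - 1‖ := fun n h1 h2 =>
    (by linarith [hlow n h1 h2] : 4 * θ ≤ 4 * |φ (n + 1) - φ n|).trans
      (four_mul_abs_le_norm_phase_sub_one (hup n h1 h2))
  have hne : ∀ n, a ≤ n → n ≤ b → phase (φ (n + 1) - φ n) - 1 ≠ 0 := fun n h1 h2 h => by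
    have := hge n h1 h2
    rw [h, norm_zero] at this
    linarith
  have hwn : ∀ n, a ≤ n → n ≤ b → ‖w n‖ ≤ 1 / (4 * θ) := fun n h1 h2 => by
    rw [hw, norm_inv, ← one_div]
    exact one_div_le_one_div_of_le (by positivity) (hge n h1 h2)
  have hwd : ∀ n, a ≤ n → n + 1 ≤ b → ‖w (n + 1) - w n‖ ≤ η / θ ^ 2 := fun n h1 h2 => by
    have hη := hsec n h1 (by omega)
    have e1 : w (n + 1) - w n = w (n + 1) * w n *
        (phase (φ (n + 1) - φ n) - phase (φ (n + 2) - φ (n + 1))) := by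
      have := hne n h1 (by omega)
      have := hne (n + 1) (by omega) h2
      simp only [hw]
      field_simp
      ring
    rw [e1, norm_mul, norm_mul]
    have h3 := norm_phase_sub_phase_le (φ (n + 1) - φ n) (φ (n + 2) - φ (n + 1))
    rw [abs_sub_comm] at h3
    have h4 : ‖phase (φ (n + 1) - φ n) - phase (φ (n + 2) - φ (n + 1))‖ ≤ 8 * η := by
      nlinarith [pi_pos, pi_le_four, abs_nonneg ((φ (n + 2) - φ (n + 1)) - (φ (n + 1) - φ n))]
    calc ‖w (n + 1)‖ * ‖w n‖ * ‖phase (φ (n + 1) - φ n) - phase (φ (n + 2) - φ (n + 1))‖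
        ≤ 1 / (4 * θ) * (1 / (4 * θ)) * (8 * η) := by
          gcongr
          · exact hwn _ (by omega) h2
          · exact hwn _ h1 (by omega)
      _ = (η / θ ^ 2) / 2 := by field_simp; ring
      _ ≤ η / θ ^ 2 := by
          have : 0 ≤ η / θ ^ 2 := div_nonneg ((abs_nonneg _).trans hη) (by positivity)
          linarith
  have key : ∀ m, a ≤ m → m ≤ b →
      ‖(∑ n ∈ Ioc a m, phase (φ n)) - phase (φ (m + 1)) * w m‖
        ≤ 1 / (4 * θ) + ((m : ℝ) - a) * (η / θ ^ 2) := by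
    intro m hm
    induction m, hm using Nat.le_induction with
    | base =>
      intro h
      simpa [norm_phase] using hwn a le_rfl h
    | succ m hm ih =>
      intro h
      have h1 : phase (φ (m + 2)) = phase (φ (m + 1)) * phase (φ (m + 2) - φ (m + 1)) := by
        rw [← phase_add, add_sub_cancel]
      have h2 : phase (φ (m + 2)) * w (m + 1)
          = phase (φ (m + 1)) + phase (φ (m + 1)) * w (m + 1) := by
        have := hne (m + 1) (by omega) h
        rw [h1]
        simp only [hw]
        field_simp
        ring
      have h3 : (∑ n ∈ Ioc a (m + 1), phase (φ n)) - phase (φ (m + 1 + 1)) * w (m + 1)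
          = ((∑ n ∈ Ioc a m, phase (φ n)) - phase (φ (m + 1)) * w m)
            - phase (φ (m + 1)) * (w (m + 1) - w m) := by
        rw [Finset.sum_Ioc_succ_top hm, show m + 1 + 1 = m + 2 from rfl, h2]
        ring
      rw [h3]
      refine (norm_sub_le _ _).trans ?_
      rw [norm_mul, norm_phase, one_mul]
      have := ih (by omega)
      have := hwd m hm h
      push_cast
      linarith
  have hb := key b hab le_rfl
  have h1 : ‖phase (φ (b + 1)) * w b‖ ≤ 1 / (4 * θ) := by
    rw [norm_mul, norm_phase, one_mul]
    exact hwn b hab le_rfl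
  have h2 := norm_add_le ((∑ n ∈ Ioc a b, phase (φ n)) - phase (φ (b + 1)) * w b)
    (phase (φ (b + 1)) * w b)
  rw [sub_add_cancel] at h2
  have h3 : 1 / (4 * θ) = 1 / θ / 4 := by field_simp
  have h4 : 0 < 1 / θ := by positivity
  linarith

lemma sum_norm_sum_sq_le {w : ℕ → ℕ → ℂ} {s : Finset ℕ} {Q : ℕ} {T : ℝ} (hT0 : 0 ≤ T)
    (hw : ∀ q n, ‖w q n‖ ≤ 1)
    (hT : ∀ p q, p < q → q < Q → ‖∑ n ∈ s, w q n * conj (w p n)‖ ≤ T) :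
    ∑ n ∈ s, ‖∑ q ∈ range Q, w q n‖ ^ 2 ≤ Q * (#s : ℝ) + (Q : ℝ) ^ 2 * T := by
  have hpair : ∀ q ∈ range Q, ∀ p ∈ range Q,
      ‖∑ n ∈ s, w q n * conj (w p n)‖ ≤ (if p = q then (#s : ℝ) else 0) + T := by
    intro q hq p hp
    rw [Finset.mem_range] at hq hp
    rcases lt_trichotomy p q with h | h | h
    · simpa [h.ne] using hT p q h hq
    · subst h
      simp only [if_true]
      have : ‖∑ n ∈ s, w p n * conj (w p n)‖ ≤ ∑ n ∈ s, (1 : ℝ) := by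
        refine norm_sum_le_of_le _ fun n _ => ?_
        rw [norm_mul, RCLike.norm_conj]
        exact mul_le_one₀ (hw _ _) (norm_nonneg _) (hw _ _)
      rw [Finset.sum_const, nsmul_eq_mul, mul_one] at this
      linarith
    · have h1 : ∑ n ∈ s, w q n * conj (w p n) = conj (∑ n ∈ s, w p n * conj (w q n)) := by
        rw [map_sum]
        refine Finset.sum_congr rfl fun n _ => ?_
        rw [map_mul, Complex.conj_conj, mul_comm]
      rw [h1, RCLike.norm_conj]
      simpa [h.ne'] using hT q p h hp
  have hid : ((∑ n ∈ s, ‖∑ q ∈ range Q, w q n‖ ^ 2 : ℝ) : ℂ)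
      = ∑ q ∈ range Q, ∑ p ∈ range Q, ∑ n ∈ s, w q n * conj (w p n) := by
    push_cast
    rw [Finset.sum_congr rfl fun q _ => Finset.sum_comm, Finset.sum_comm]
    refine Finset.sum_congr rfl fun n _ => ?_
    rw [← Complex.mul_conj', map_sum, Finset.sum_mul_sum]
  have h0 : (0 : ℝ) ≤ ∑ n ∈ s, ‖∑ q ∈ range Q, w q n‖ ^ 2 :=
    Finset.sum_nonneg fun _ _ => sq_nonneg _
  calc ∑ n ∈ s, ‖∑ q ∈ range Q, w q n‖ ^ 2
      = ‖((∑ n ∈ s, ‖∑ q ∈ range Q, w q n‖ ^ 2 : ℝ) : ℂ)‖ := by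
        rw [Complex.norm_real, Real.norm_of_nonneg h0]
    _ ≤ ∑ q ∈ range Q, ∑ p ∈ range Q, ((if p = q then (#s : ℝ) else 0) + T) := by
        rw [hid]
        exact norm_sum_le_of_le _ fun q hq => norm_sum_le_of_le _ fun p hp => hpair q hq p hp
    _ = ∑ q ∈ range Q, ((#s : ℝ) + Q * T) := by
        refine Finset.sum_congr rfl fun q hq => ?_
        rw [Finset.sum_add_distrib, Finset.sum_ite_eq', if_pos hq]
        simp
    _ = Q * (#s : ℝ) + (Q : ℝ) ^ 2 * T := by
        rw [Finset.sum_const, Finset.card_range, nsmul_eq_mul]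
        ring

lemma sum_Ioc_shift (z : ℕ → ℂ) (a b s : ℕ) :
    ∑ n ∈ Ioc a b, z (n + s) = ∑ n ∈ Ioc (a + s) (b + s), z n := by
  rw [← Finset.image_add_right_Ioc, Finset.sum_image (by simp)]

lemma norm_sum_Ioc_shift_sub_le {z : ℕ → ℂ} (hz : ∀ n, ‖z n‖ ≤ 1) {a b : ℕ} (hab : a ≤ b)
    (s : ℕ) : ‖∑ n ∈ Ioc a b, z n - ∑ n ∈ Ioc a b, z (n + s)‖ ≤ 2 * s := by
  induction s with
  | zero => simp
  | succ s ih =>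
    have htel : ∀ m, a ≤ m →
        ∑ n ∈ Ioc a m, (z (n + s) - z (n + (s + 1))) = z (a + s + 1) - z (m + s + 1) := by
      intro m hm
      induction m, hm using Nat.le_induction with
      | base => simp
      | succ m hm ih =>
        rw [Finset.sum_Ioc_succ_top hm, ih, show m + 1 + s = m + s + 1 by ring,
          show m + 1 + (s + 1) = m + s + 1 + 1 by ring]
        ring
    have h1 : ∑ n ∈ Ioc a b, z n - ∑ n ∈ Ioc a b, z (n + (s + 1))
        = (∑ n ∈ Ioc a b, z n - ∑ n ∈ Ioc a b, z (n + s)) + (z (a + s + 1) - z (b + s + 1)) := by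
      rw [← htel b hab, Finset.sum_sub_distrib]
      ring
    rw [h1]
    have h2 := norm_add_le (∑ n ∈ Ioc a b, z n - ∑ n ∈ Ioc a b, z (n + s))
      (z (a + s + 1) - z (b + s + 1))
    have h3 := norm_sub_le (z (a + s + 1)) (z (b + s + 1))
    push_cast
    linarith [hz (a + s + 1), hz (b + s + 1)]

/-- The van der Corput inequality with shifts that are multiples of a step `D`. -/
lemma norm_sum_le_vanDerCorput {z : ℕ → ℂ} (hz : ∀ n, ‖z n‖ ≤ 1) {a b D Q : ℕ} (hab : a ≤ b)
    (hQ : 0 < Q) {T : ℝ} (hT0 : 0 ≤ T)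
    (hT : ∀ q, 0 < q → q < Q → ∀ s ≤ D * Q,
      ‖∑ n ∈ Ioc (a + s) (b + s), z (n + D * q) * conj (z n)‖ ≤ T) :
    ‖∑ n ∈ Ioc a b, z n‖
      ≤ 2 * (D * Q : ℝ) + √(((b : ℝ) - a) * (((b : ℝ) - a) / Q + T)) := by
  have hQ' : (0 : ℝ) < Q := by exact_mod_cast hQ
  have hN : (#(Ioc a b) : ℝ) = (b : ℝ) - a := by
    rw [Nat.card_Ioc, Nat.cast_sub hab]
  have hsq := sum_norm_sum_sq_le (w := fun q n => z (n + D * q)) (s := Ioc a b) (Q := Q) hT0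
    (fun q n => hz _) (by
      intro p q hpq hq
      have h1 := hT (q - p) (by omega) (by omega) (D * p) (Nat.mul_le_mul_left D (by omega))
      rw [← sum_Ioc_shift] at h1
      convert h1 using 4 with n
      have : D * q = D * p + D * (q - p) := by
        rw [← Nat.mul_add]
        congr 1
        omega
      rw [this]
      ring_nf)
  rw [hN] at hsq
  set N : ℝ := (b : ℝ) - a
  have hN0 : 0 ≤ N := by rw [← hN]; positivity
  have hdouble : ‖∑ q ∈ range Q, ∑ n ∈ Ioc a b, z (n + D * q)‖ ≤ Q * √(N * (N / Q + T)) := by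
    rw [Finset.sum_comm]
    refine (norm_sum_le _ _).trans ?_
    have hcs := sq_sum_le_card_mul_sum_sq (s := Ioc a b)
      (f := fun n => ‖∑ q ∈ range Q, z (n + D * q)‖)
    rw [hN] at hcs
    have h1 : (∑ n ∈ Ioc a b, ‖∑ q ∈ range Q, z (n + D * q)‖) ^ 2
        ≤ (Q : ℝ) ^ 2 * (N * (N / Q + T)) := by
      refine (hcs.trans (mul_le_mul_of_nonneg_left hsq hN0)).trans_eq ?_
      field_simp
    have h2 := Real.le_sqrt_of_sq_le h1
    rwa [Real.sqrt_mul (by positivity), Real.sqrt_sq hQ'.le] at h2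
  have hdiff : ‖∑ q ∈ range Q, (∑ n ∈ Ioc a b, z n - ∑ n ∈ Ioc a b, z (n + D * q))‖
      ≤ Q * (2 * (D * Q : ℝ)) := by
    have : ‖∑ q ∈ range Q, (∑ n ∈ Ioc a b, z n - ∑ n ∈ Ioc a b, z (n + D * q))‖
        ≤ ∑ q ∈ range Q, 2 * (D * Q : ℝ) := by
      refine norm_sum_le_of_le _ fun q hq => ?_
      refine (norm_sum_Ioc_shift_sub_le hz hab (D * q)).trans ?_
      have : (q : ℝ) ≤ Q := by exact_mod_cast (Finset.mem_range.1 hq).le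
      push_cast
      gcongr
    simpa using this
  have hS : (Q : ℂ) * ∑ n ∈ Ioc a b, z n
      = ∑ q ∈ range Q, (∑ n ∈ Ioc a b, z n - ∑ n ∈ Ioc a b, z (n + D * q))
        + ∑ q ∈ range Q, ∑ n ∈ Ioc a b, z (n + D * q) := by
    rw [Finset.sum_sub_distrib]
    simp
  have h3 := norm_add_le (∑ q ∈ range Q, (∑ n ∈ Ioc a b, z n - ∑ n ∈ Ioc a b, z (n + D * q)))
    (∑ q ∈ range Q, ∑ n ∈ Ioc a b, z (n + D * q))
  rw [← hS, norm_mul, Complex.norm_natCast] at h3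
  refine le_of_mul_le_mul_left ?_ hQ'
  linarith

lemma hasDerivAt_foldr_fwdDiff {g : ℕ → ℝ → ℝ}
    (hg : ∀ k x, 0 < x → HasDerivAt (g k) (g (k + 1) x) x) (l : List ℝ) (hl : ∀ r ∈ l, 0 < r)
    (k : ℕ) {x : ℝ} (hx : 0 < x) :
    HasDerivAt (l.foldr fwdDiff (g k)) (l.foldr fwdDiff (g (k + 1)) x) x := by
  induction l generalizing x with
  | nil => exact hg k x hx
  | cons r l ih =>
    have hl' : ∀ r ∈ l, 0 < r := fun s hs => hl s (List.mem_cons_of_mem _ hs)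
    have hr : 0 < r := hl r List.mem_cons_self
    simp only [List.foldr_cons]
    have hadd := ih hl' (x := x + r) (by linarith)
    have hself := ih hl' hx
    exact (hadd.comp_add_const x r).sub hself

/-- The mean value theorem for iterated forward differences. -/
lemma exists_foldr_fwdDiff_eq {g : ℕ → ℝ → ℝ}
    (hg : ∀ k x, 0 < x → HasDerivAt (g k) (g (k + 1) x) x) (l : List ℝ) (hl : ∀ r ∈ l, 0 < r)
    (k : ℕ) {x : ℝ} (hx : 0 < x) :
    ∃ ξ, x ≤ ξ ∧ ξ ≤ x + l.sum ∧ l.foldr fwdDiff (g k) x = l.prod * g (k + l.length) ξ := by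
  induction l generalizing x k with
  | nil => exact ⟨x, le_rfl, by simp, by simp⟩
  | cons r l ih =>
    have hl' : ∀ r ∈ l, 0 < r := fun s hs => hl s (List.mem_cons_of_mem _ hs)
    have hr : 0 < r := hl r List.mem_cons_self
    have hder : ∀ y, x ≤ y →
        HasDerivAt (l.foldr fwdDiff (g k)) (l.foldr fwdDiff (g (k + 1)) y) y := fun y hy =>
      hasDerivAt_foldr_fwdDiff hg l hl' k (hx.trans_le hy)
    obtain ⟨y, hy, hy'⟩ := exists_hasDerivAt_eq_slope (l.foldr fwdDiff (g k))
      (l.foldr fwdDiff (g (k + 1))) (show x < x + r by linarith)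
      (fun y hy => (hder y hy.1).continuousAt.continuousWithinAt) (fun y hy => hder y hy.1.le)
    obtain ⟨ξ, h1, h2, h3⟩ := ih hl' (k + 1) (hx.trans hy.1)
    refine ⟨ξ, hy.1.le.trans h1, ?_, ?_⟩
    · rw [List.sum_cons]
      linarith [hy.2]
    · rw [List.foldr_cons, fwdDiff, List.prod_cons, List.length_cons]
      rw [h3, add_sub_cancel_left, eq_div_iff hr.ne'] at hy'
      rw [← hy', show k + (l.length + 1) = k + 1 + l.length by ring]
      ring

/-- The `k`-th derivative of `x ↦ x ^ c` on the positive reals. -/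
noncomputable def powDeriv (c : ℝ) (k : ℕ) (x : ℝ) : ℝ :=
  (∏ i ∈ range k, (c - i)) * x ^ (c - k)

lemma powDeriv_zero (c x : ℝ) : powDeriv c 0 x = x ^ c := by simp [powDeriv]

lemma hasDerivAt_powDeriv (c : ℝ) (k : ℕ) (x : ℝ) (hx : 0 < x) :
    HasDerivAt (powDeriv c k) (powDeriv c (k + 1) x) x := by
  have h := (Real.hasDerivAt_rpow_const (x := x) (p := c - k) (Or.inl hx.ne')).const_mul
    (∏ i ∈ range k, (c - i))
  refine h.congr_deriv ?_
  rw [powDeriv, Finset.prod_range_succ]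
  push_cast
  rw [show c - (k + 1 : ℝ) = c - k - 1 by ring]
  ring

lemma rpow_le_of_half_le {s X ξ : ℝ} (hs : s ≤ 0) (hX : 0 < X) (hξ : X / 2 ≤ ξ) :
    ξ ^ s ≤ 2 ^ (-s) * X ^ s := by
  calc ξ ^ s ≤ (X / 2) ^ s := Real.rpow_le_rpow_of_nonpos (by positivity) hξ hs
    _ = 2 ^ (-s) * X ^ s := by
      rw [Real.div_rpow hX.le (by norm_num), Real.rpow_neg (by norm_num)]
      ring

lemma le_rpow_of_le_eight_mul {s X ξ : ℝ} (hs : s ≤ 0) (hξ0 : 0 < ξ) (hX : 0 < X)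
    (hξ : ξ ≤ 8 * X) : 8 ^ s * X ^ s ≤ ξ ^ s := by
  rw [← Real.mul_rpow (by norm_num) hX.le]
  exact Real.rpow_le_rpow_of_nonpos hξ0 hξ hs

/-- The exponential sum over second differences of `h * x ^ c`, in the range where the third
differences are small. -/
lemma norm_sum_phase_fwdDiff_le {c κ κ' : ℝ} (hc1 : 1 < c) (hc2 : c < 3)
    (hκ : κ = |c * (c - 1) * (c - 2)|) (hκ0 : 0 < κ) (hκ' : κ' = |c * (c - 1) * (c - 2) * (c - 3)|)
    {X h r₁ r₂ : ℝ} (hX : 0 < X) (hh : 0 < h) (hr₁ : 0 < r₁) (hr₂ : 0 < r₂)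
    (hr : 2 + r₁ + r₂ ≤ 4 * X) (hsmall : 4 * κ * (h * r₁ * r₂ * X ^ (c - 3)) ≤ 1 / 2)
    {a b : ℕ} (hab : a ≤ b) (ha : X / 2 ≤ a) (hb : b ≤ 4 * X) :
    ‖∑ n ∈ Ioc a b, phase (h * fwdDiff r₂ (fwdDiff r₁ (fun x : ℝ => x ^ c)) n)‖
      ≤ (64 / κ + 131072 * κ' / κ ^ 2) / (h * r₁ * r₂ * X ^ (c - 3)) := by
  have hf : (fun x : ℝ => x ^ c) = powDeriv c 0 := by
    ext x
    rw [powDeriv_zero]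
  set F : ℝ → ℝ := fwdDiff r₂ (fwdDiff r₁ (fun x : ℝ => x ^ c)) with hF
  set L : ℝ := h * r₁ * r₂ * X ^ (c - 3) with hL
  have hXs : 0 < X ^ (c - 3) := Real.rpow_pos_of_pos hX _
  have hL0 : 0 < L := by positivity
  have hκ'0 : 0 ≤ κ' := hκ' ▸ abs_nonneg _
  have hthird : ∀ n : ℕ, a ≤ n → n ≤ b →
      κ / 64 * L ≤ |h * F (n + 1 : ℕ) - h * F n| ∧ |h * F (n + 1 : ℕ) - h * F n| ≤ 4 * κ * L := by
    intro n h1 h2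
    have h1' : (a : ℝ) ≤ n := by exact_mod_cast h1
    have h2' : (n : ℝ) ≤ b := by exact_mod_cast h2
    obtain ⟨ξ, hξ1, hξ2, hξ⟩ := exists_foldr_fwdDiff_eq (hasDerivAt_powDeriv c) [1, r₂, r₁]
      (by simp [hr₁, hr₂]) 0 (x := n) (by linarith)
    have hξ0 : 0 < ξ := by linarith
    simp only [List.sum_cons, List.sum_nil] at hξ2
    have e : h * F (n + 1 : ℕ) - h * F n = h * r₁ * r₂ * (c * (c - 1) * (c - 2)) * ξ ^ (c - 3) := by
      have : F (n + 1 : ℕ) - F n = List.foldr fwdDiff (powDeriv c 0) [1, r₂, r₁] n := by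
        simp only [List.foldr_cons, List.foldr_nil, ← hf, ← hF]
        rw [fwdDiff, Nat.cast_succ]
      rw [← mul_sub, this, hξ]
      simp [powDeriv, Finset.prod_range_succ]
      ring
    rw [e, abs_mul, abs_mul, abs_of_pos (by positivity : 0 < h * r₁ * r₂), ← hκ,
      abs_of_pos (Real.rpow_pos_of_pos hξ0 _)]
    have hlo := le_rpow_of_le_eight_mul (s := c - 3) (by linarith) hξ0 hX (by linarith)
    have hup := rpow_le_of_half_le (s := c - 3) (by linarith) hX (ξ := ξ) (by linarith)
    have h8 : (1 : ℝ) / 64 ≤ 8 ^ (c - 3) := by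
      have := Real.rpow_le_rpow_of_exponent_le (x := 8) (by norm_num) (show -2 ≤ c - 3 by linarith)
      refine le_trans (le_of_eq ?_) this
      rw [Real.rpow_neg (by norm_num)]
      norm_num
    have h4 : (2 : ℝ) ^ (-(c - 3)) ≤ 4 := by
      have := Real.rpow_le_rpow_of_exponent_le (x := 2) (by norm_num)
        (show -(c - 3) ≤ 2 by linarith)
      refine this.trans (le_of_eq ?_)
      norm_num
    constructor
    · calc κ / 64 * L = h * r₁ * r₂ * κ * (1 / 64 * X ^ (c - 3)) := by rw [hL]; ring
        _ ≤ h * r₁ * r₂ * κ * (8 ^ (c - 3) * X ^ (c - 3)) := by gcongr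
        _ ≤ _ := by gcongr
    · calc h * r₁ * r₂ * κ * ξ ^ (c - 3)
          ≤ h * r₁ * r₂ * κ * (2 ^ (-(c - 3)) * X ^ (c - 3)) := by gcongr
        _ ≤ h * r₁ * r₂ * κ * (4 * X ^ (c - 3)) := by gcongr
        _ = 4 * κ * L := by rw [hL]; ring
  have hfourth : ∀ n : ℕ, a ≤ n → n ≤ b →
      |(h * F (n + 2 : ℕ) - h * F (n + 1 : ℕ)) - (h * F (n + 1 : ℕ) - h * F n)|
        ≤ 8 * κ' * L / X := by
    intro n h1 h2
    have h1' : (a : ℝ) ≤ n := by exact_mod_cast h1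
    obtain ⟨ξ, hξ1, hξ2, hξ⟩ := exists_foldr_fwdDiff_eq (hasDerivAt_powDeriv c) [1, 1, r₂, r₁]
      (by simp [hr₁, hr₂]) 0 (x := n) (by linarith)
    have hξ0 : 0 < ξ := by linarith
    have e : (h * F (n + 2 : ℕ) - h * F (n + 1 : ℕ)) - (h * F (n + 1 : ℕ) - h * F n)
        = h * r₁ * r₂ * (c * (c - 1) * (c - 2) * (c - 3)) * ξ ^ (c - 4) := by
      have : (F (n + 2 : ℕ) - F (n + 1 : ℕ)) - (F (n + 1 : ℕ) - F n)
          = List.foldr fwdDiff (powDeriv c 0) [1, 1, r₂, r₁] n := by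
        simp only [List.foldr_cons, List.foldr_nil, ← hf, ← hF]
        simp only [fwdDiff]
        push_cast
        rw [show (n : ℝ) + 2 = n + 1 + 1 by ring]
      rw [← mul_sub, ← mul_sub, ← mul_sub, this, hξ]
      simp [powDeriv, Finset.prod_range_succ]
      ring
    rw [e, abs_mul, abs_mul, abs_of_pos (by positivity : 0 < h * r₁ * r₂), ← hκ',
      abs_of_pos (Real.rpow_pos_of_pos hξ0 _)]
    have hup := rpow_le_of_half_le (s := c - 4) (by linarith) hX (ξ := ξ) (by linarith)
    have h4 : (2 : ℝ) ^ (-(c - 4)) ≤ 8 := by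
      have := Real.rpow_le_rpow_of_exponent_le (x := 2) (by norm_num)
        (show -(c - 4) ≤ 3 by linarith)
      refine this.trans (le_of_eq ?_)
      norm_num
    have hX4 : X ^ (c - 4) = X ^ (c - 3) / X := by
      rw [show c - 4 = c - 3 - 1 by ring, Real.rpow_sub_one hX.ne']
    have := Real.rpow_pos_of_pos hX (c - 4)
    calc h * r₁ * r₂ * κ' * ξ ^ (c - 4)
        ≤ h * r₁ * r₂ * κ' * (2 ^ (-(c - 4)) * X ^ (c - 4)) := by gcongr
      _ ≤ h * r₁ * r₂ * κ' * (8 * X ^ (c - 4)) := by gcongr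
      _ = 8 * κ' * L / X := by rw [hL, hX4]; ring
  refine (norm_sum_phase_le (φ := fun n : ℕ => h * F n) hab (θ := κ / 64 * L) (by positivity)
    (fun n h1 h2 => (hthird n h1 h2).1) (fun n h1 h2 => (hthird n h1 h2).2.trans hsmall)
    hfourth).trans ?_
  have hba : (b : ℝ) - a ≤ 4 * X := by
    have : (0 : ℝ) ≤ a := by positivity
    linarith
  calc 1 / (κ / 64 * L) + ((b : ℝ) - a) * (8 * κ' * L / X / (κ / 64 * L) ^ 2)
      ≤ 1 / (κ / 64 * L) + (4 * X) * (8 * κ' * L / X / (κ / 64 * L) ^ 2) := by gcongr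
    _ = (64 / κ + 131072 * κ' / κ ^ 2) / L := by
      field_simp
      ring

/-- A power-saving bound for the exponential sum over `h * n ^ c`, for `n` of size `Y ^ 64` and
`h ≤ Y`. -/
lemma exists_norm_sum_phase_rpow_le {c : ℝ} (hc1 : 1 < c) (hc2 : c < 5 / 2) (hc3 : c ≠ 2) :
    ∃ C > 0, ∃ Y₀ ≥ 1, ∀ Y : ℝ, Y₀ ≤ Y → ∀ h : ℕ, 0 < h → (h : ℝ) ≤ Y →
      ‖∑ n ∈ Ioc ⌊Y ^ 64⌋₊ ⌊2 * Y ^ 64⌋₊, phase (h * (n : ℝ) ^ c)‖ ≤ C * Y ^ 63 := by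
  set κ : ℝ := |c * (c - 1) * (c - 2)| with hκ
  have hκ0 : 0 < κ := by
    refine abs_pos.2 (mul_ne_zero (mul_ne_zero ?_ ?_) (sub_ne_zero.2 hc3)) <;> linarith
  set κ' : ℝ := |c * (c - 1) * (c - 2) * (c - 3)| with hκ'
  have hκ'0 : 0 ≤ κ' := abs_nonneg _
  set C₂ : ℝ := 64 / κ + 131072 * κ' / κ ^ 2 with hC₂
  have hC₂0 : 0 < C₂ := by positivity
  set C₁ : ℝ := 8 + √(4 * (4 + C₂)) with hC₁
  have hC₁0 : 0 < C₁ := by positivity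
  refine ⟨8 + √(4 * (4 + C₁)), by positivity, 8 + 128 * κ, by linarith, ?_⟩
  intro Y hY h hh hhY
  have hY8 : 8 ≤ Y := by linarith
  have hY1 : 1 ≤ Y := by linarith
  have hY0 : 0 < Y := by linarith
  set X : ℝ := Y ^ 64 with hX
  have hX0 : 0 < X := by positivity
  have hX1 : 1 ≤ X := one_le_pow₀ hY1
  have hX8 : 8 ≤ X := hY8.trans (le_self_pow₀ hY1 (by norm_num))
  set E : ℝ := X ^ ((5 / 2 - c) / 2) with hE
  have hE1 : 1 ≤ E := Real.one_le_rpow hX1 (by linarith)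
  have hEup : E ≤ Y ^ 48 := by
    calc E ≤ X ^ ((3 : ℝ) / 4) := Real.rpow_le_rpow_of_exponent_le hX1 (by linarith)
      _ = Y ^ 48 := by
        rw [hX, ← Real.rpow_natCast Y 64, ← Real.rpow_mul hY0.le, ← Real.rpow_natCast Y 48]
        norm_num
  have hEX : E ^ 2 * X ^ (c - 3) * Y ^ 32 = 1 := by
    have h32 : Y ^ 32 = X ^ ((1 : ℝ) / 2) := by
      rw [hX, ← Real.rpow_natCast Y 64, ← Real.rpow_mul hY0.le, ← Real.rpow_natCast Y 32]
      norm_num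
    rw [h32, hE, ← Real.rpow_natCast, ← Real.rpow_mul hX0.le, ← Real.rpow_add hX0,
      ← Real.rpow_add hX0]
    rw [show (5 / 2 - c) / 2 * ((2 : ℕ) : ℝ) + (c - 3) + 1 / 2 = 0 by push_cast; ring,
      Real.rpow_zero]
  set D : ℕ := ⌈E⌉₊ with hD
  have hDlo : E ≤ D := Nat.le_ceil _
  have hDup : (D : ℝ) ≤ 2 * E := by
    have := Nat.ceil_lt_add_one (show 0 ≤ E by linarith)
    linarith
  have hD0 : 0 < D := by
    have : (0 : ℝ) < D := by linarith
    exact_mod_cast this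
  have hY4 : 1 ≤ Y ^ 4 := one_le_pow₀ hY1
  set Q : ℕ := ⌈Y ^ 4⌉₊ with hQ
  have hQlo : Y ^ 4 ≤ Q := Nat.le_ceil _
  have hQup : (Q : ℝ) ≤ 2 * Y ^ 4 := by
    have := Nat.ceil_lt_add_one (show 0 ≤ Y ^ 4 by linarith)
    linarith
  have hQ0 : 0 < Q := by
    have : (0 : ℝ) < Q := by linarith
    exact_mod_cast this
  have hDQ : (D : ℝ) * Q ≤ 4 * Y ^ 52 := by
    calc (D : ℝ) * Q ≤ (2 * Y ^ 48) * (2 * Y ^ 4) := by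
          gcongr
          linarith
      _ = 4 * Y ^ 52 := by ring
  have hDQX : (D : ℝ) * Q ≤ X / 2 := by
    refine hDQ.trans ?_
    have : 8 * Y ^ 52 ≤ X := by
      calc 8 * Y ^ 52 ≤ Y ^ 12 * Y ^ 52 := by
            gcongr
            exact hY8.trans (le_self_pow₀ hY1 (by norm_num))
        _ = X := by rw [hX]; ring
    linarith
  have hh1 : (1 : ℝ) ≤ h := by exact_mod_cast hh
  set a : ℕ := ⌊X⌋₊ with ha
  set b : ℕ := ⌊2 * X⌋₊ with hb
  have hab : a ≤ b := Nat.floor_mono (by linarith)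
  have halo : X / 2 ≤ a := by
    have := Nat.lt_floor_add_one X
    linarith
  have hbup : (b : ℝ) ≤ 2 * X := Nat.floor_le (by linarith)
  have hN0 : (0 : ℝ) ≤ (b : ℝ) - a := sub_nonneg.2 (by exact_mod_cast hab)
  have hNup : (b : ℝ) - a ≤ 4 * X := by linarith
  have hNQ : ((b : ℝ) - a) / Q ≤ 4 * Y ^ 60 := by
    rw [div_le_iff₀ (by linarith)]
    calc (b : ℝ) - a ≤ 4 * Y ^ 60 * Y ^ 4 := by rw [hX] at hNup; linarith
      _ ≤ 4 * Y ^ 60 * Q := by gcongr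
  have hinner : ∀ q₁, 0 < q₁ → q₁ < Q → ∀ s ≤ D * Q,
      ‖∑ n ∈ Ioc (a + s) (b + s),
        phase (h * fwdDiff ((D * q₁ : ℕ) : ℝ) (fun x : ℝ => x ^ c) n)‖ ≤ C₁ * Y ^ 62 := by
    intro q₁ hq₁ hq₁Q s hs
    have hT : ∀ q₂, 0 < q₂ → q₂ < Q → ∀ t ≤ D * Q,
        ‖∑ n ∈ Ioc (a + s + t) (b + s + t),
          phase (h * fwdDiff ((D * q₁ : ℕ) : ℝ) (fun x : ℝ => x ^ c) (n + D * q₂ : ℕ))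
            * conj (phase (h * fwdDiff ((D * q₁ : ℕ) : ℝ) (fun x : ℝ => x ^ c) n))‖
          ≤ C₂ * Y ^ 60 := by
      intro q₂ hq₂ hq₂Q t ht
      have hs' : (s : ℝ) ≤ D * Q := by exact_mod_cast hs
      have ht' : (t : ℝ) ≤ D * Q := by exact_mod_cast ht
      have hs0 : (0 : ℝ) ≤ s := by positivity
      have ht0 : (0 : ℝ) ≤ t := by positivity
      have h11 : (1 : ℝ) ≤ q₁ := by exact_mod_cast hq₁
      have h21 : (1 : ℝ) ≤ q₂ := by exact_mod_cast hq₂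
      have h1Q : (q₁ : ℝ) ≤ Q := by exact_mod_cast hq₁Q.le
      have h2Q : (q₂ : ℝ) ≤ Q := by exact_mod_cast hq₂Q.le
      have hD0' : (0 : ℝ) < D := by linarith
      have hXs : 0 < X ^ (c - 3) := Real.rpow_pos_of_pos hX0 _
      have hr1 : ((D * q₁ : ℕ) : ℝ) ≤ X / 2 := by
        push_cast
        exact (mul_le_mul_of_nonneg_left h1Q hD0'.le).trans hDQX
      have hr2 : ((D * q₂ : ℕ) : ℝ) ≤ X / 2 := by
        push_cast
        exact (mul_le_mul_of_nonneg_left h2Q hD0'.le).trans hDQX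
      have hup : h * ((D * q₁ : ℕ) : ℝ) * ((D * q₂ : ℕ) : ℝ) * X ^ (c - 3) * Y ^ 23 ≤ 16 := by
        push_cast
        calc h * ((D : ℝ) * q₁) * (D * q₂) * X ^ (c - 3) * Y ^ 23
            ≤ Y * (2 * E * (2 * Y ^ 4)) * (2 * E * (2 * Y ^ 4)) * X ^ (c - 3) * Y ^ 23 := by
              gcongr
              · exact h1Q.trans hQup
              · exact h2Q.trans hQup
          _ = 16 * (E ^ 2 * X ^ (c - 3) * Y ^ 32) := by ring
          _ = 16 := by rw [hEX]; norm_num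
      have hlo : 1 ≤ h * ((D * q₁ : ℕ) : ℝ) * ((D * q₂ : ℕ) : ℝ) * X ^ (c - 3) * Y ^ 32 := by
        push_cast
        calc (1 : ℝ) = E ^ 2 * X ^ (c - 3) * Y ^ 32 := hEX.symm
          _ = 1 * (E * 1) * (E * 1) * X ^ (c - 3) * Y ^ 32 := by ring
          _ ≤ h * ((D : ℝ) * q₁) * (D * q₂) * X ^ (c - 3) * Y ^ 32 := by gcongr
      set L : ℝ := h * ((D * q₁ : ℕ) : ℝ) * ((D * q₂ : ℕ) : ℝ) * X ^ (c - 3) with hL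
      have hL0 : 0 < L := by
        rw [hL]
        push_cast
        positivity
      have hsmall : 4 * κ * L ≤ 1 / 2 := by
        have h23 : 128 * κ ≤ Y ^ 23 :=
          (by linarith : 128 * κ ≤ Y).trans (le_self_pow₀ hY1 (by norm_num))
        have := mul_le_mul_of_nonneg_left h23 hL0.le
        linarith
      have hb4 : ((b + s + t : ℕ) : ℝ) ≤ 4 * X := by
        push_cast
        linarith
      have ha4 : X / 2 ≤ ((a + s + t : ℕ) : ℝ) := by
        push_cast
        linarith
      have hmain := norm_sum_phase_fwdDiff_le (X := X) hc1 (by linarith) hκ hκ0 hκ'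
        (h := h) (r₁ := (D * q₁ : ℕ)) (r₂ := (D * q₂ : ℕ)) hX0 (by linarith)
        (by push_cast; positivity) (by push_cast; positivity) (by linarith) hsmall
        (a := a + s + t) (b := b + s + t) (by omega) ha4 hb4
      have hsum : ∀ n : ℕ,
          phase (h * fwdDiff ((D * q₁ : ℕ) : ℝ) (fun x : ℝ => x ^ c) (n + D * q₂ : ℕ))
            * conj (phase (h * fwdDiff ((D * q₁ : ℕ) : ℝ) (fun x : ℝ => x ^ c) n))
          = phase (h * fwdDiff ((D * q₂ : ℕ) : ℝ) (fwdDiff ((D * q₁ : ℕ) : ℝ)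
              (fun x : ℝ => x ^ c)) n) := by
        intro n
        rw [phase_mul_conj, ← mul_sub, fwdDiff.eq_def ((D * q₂ : ℕ) : ℝ), Nat.cast_add]
      rw [Finset.sum_congr rfl fun n _ => hsum n]
      refine hmain.trans ?_
      rw [← hL, ← hC₂, div_le_iff₀ hL0]
      calc C₂ = C₂ * 1 := by ring
        _ ≤ C₂ * (L * Y ^ 32) := by gcongr
        _ ≤ C₂ * (L * Y ^ 60) := by
          gcongr
          norm_num
        _ = C₂ * Y ^ 60 * L := by ring
    have hv := norm_sum_le_vanDerCorput
      (z := fun n : ℕ => phase (h * fwdDiff ((D * q₁ : ℕ) : ℝ) (fun x : ℝ => x ^ c) n))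
      (fun n => (norm_phase _).le) (a := a + s) (b := b + s) (D := D) (by omega) hQ0
      (by positivity) hT
    refine hv.trans ?_
    have hN : ((b + s : ℕ) : ℝ) - ((a + s : ℕ) : ℝ) = (b : ℝ) - a := by
      push_cast
      ring
    rw [hN]
    have hroot : √(((b : ℝ) - a) * (((b : ℝ) - a) / Q + C₂ * Y ^ 60))
        ≤ √(4 * (4 + C₂)) * Y ^ 62 := by
      rw [← Real.sqrt_sq (show 0 ≤ Y ^ 62 by positivity), ← Real.sqrt_mul (by positivity)]
      refine Real.sqrt_le_sqrt ?_
      calc ((b : ℝ) - a) * (((b : ℝ) - a) / Q + C₂ * Y ^ 60)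
          ≤ (4 * X) * (4 * Y ^ 60 + C₂ * Y ^ 60) := by gcongr
        _ = 4 * (4 + C₂) * (Y ^ 62) ^ 2 := by rw [hX]; ring
    have h52 : Y ^ 52 ≤ Y ^ 62 := pow_le_pow_right₀ hY1 (by norm_num)
    refine (add_le_add (mul_le_mul_of_nonneg_left hDQ zero_le_two) hroot).trans ?_
    rw [hC₁, add_mul]
    linarith
  have hv := norm_sum_le_vanDerCorput (z := fun n : ℕ => phase (h * (n : ℝ) ^ c))
    (fun n => (norm_phase _).le) hab (D := D) hQ0 (T := C₁ * Y ^ 62) (by positivity) (by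
      intro q hq hqQ s hs
      refine le_trans (le_of_eq ?_) (hinner q hq hqQ s hs)
      congr 1
      refine Finset.sum_congr rfl fun n _ => ?_
      rw [phase_mul_conj, ← mul_sub, fwdDiff, Nat.cast_add])
  refine hv.trans ?_
  have hroot : √(((b : ℝ) - a) * (((b : ℝ) - a) / Q + C₁ * Y ^ 62))
      ≤ √(4 * (4 + C₁)) * Y ^ 63 := by
    rw [← Real.sqrt_sq (show 0 ≤ Y ^ 63 by positivity), ← Real.sqrt_mul (by positivity)]
    refine Real.sqrt_le_sqrt ?_
    have h60 : Y ^ 60 ≤ Y ^ 62 := pow_le_pow_right₀ hY1 (by norm_num)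
    calc ((b : ℝ) - a) * (((b : ℝ) - a) / Q + C₁ * Y ^ 62)
        ≤ (4 * X) * (4 * Y ^ 62 + C₁ * Y ^ 62) := by
          gcongr
          linarith
      _ = 4 * (4 + C₁) * (Y ^ 63) ^ 2 := by rw [hX]; ring
  have h52 : Y ^ 52 ≤ Y ^ 63 := pow_le_pow_right₀ hY1 (by norm_num)
  refine (add_le_add (mul_le_mul_of_nonneg_left hDQ zero_le_two) hroot).trans ?_
  rw [add_mul]
  linarith

lemma half_le_norm_sum_phase {K : ℕ} (hK : 0 < K) {θ : ℝ} (hθ : |θ - round θ| ≤ 1 / (6 * K)) :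
    (K : ℝ) / 2 ≤ ‖∑ k ∈ range K, phase (k * θ)‖ := by
  have hK' : (0 : ℝ) < K := by exact_mod_cast hK
  refine le_trans ?_ (Complex.re_le_norm _)
  rw [Complex.re_sum]
  have h1 : ∀ k ∈ range K, (1 : ℝ) / 2 ≤ (phase (k * θ)).re := by
    intro k hk
    have hk' : (k : ℝ) ≤ K := by exact_mod_cast (Finset.mem_range.1 hk).le
    rw [phase_re, ← Real.cos_sub_int_mul_two_pi _ (k * round θ), ← Real.cos_abs,
      ← Real.cos_pi_div_three]
    have e : 2 * π * (k * θ) - ((k * round θ : ℤ) : ℝ) * (2 * π)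
        = 2 * π * (k * (θ - round θ)) := by
      push_cast
      ring
    have hle : |2 * π * (k * (θ - round θ))| ≤ π / 3 := by
      rw [abs_mul, abs_of_pos Real.two_pi_pos, abs_mul, Nat.abs_cast]
      calc 2 * π * (k * |θ - round θ|) ≤ 2 * π * (K * (1 / (6 * K))) := by gcongr
        _ = π / 3 := by field_simp; norm_num
    rw [e]
    exact Real.cos_le_cos_of_nonneg_of_le_pi (abs_nonneg _) (by linarith [pi_pos]) hle
  have h2 := Finset.sum_le_sum h1
  rw [Finset.sum_const, Finset.card_range, nsmul_eq_mul] at h2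
  linarith

lemma card_Ioc_floor_le {X : ℝ} (hX : 0 ≤ X) : (#(Ioc ⌊X⌋₊ ⌊2 * X⌋₊) : ℝ) ≤ 2 * X := by
  refine le_trans ?_ (Nat.floor_le (by linarith : 0 ≤ 2 * X))
  rw [Nat.card_Ioc]
  exact_mod_cast Nat.sub_le _ _

/-- The number of `n` of size `Y ^ 64` with `n ^ c` within `1 / (6 * K)` of an integer has the
expected order of magnitude for `K ≤ Y`. -/
lemma exists_card_near_integer_le {c : ℝ} (hc1 : 1 < c) (hc2 : c < 5 / 2) (hc3 : c ≠ 2) :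
    ∃ C > 0, ∃ Y₀ ≥ 1, ∀ Y : ℝ, Y₀ ≤ Y → ∀ K : ℕ, 0 < K → (K : ℝ) ≤ Y →
      (#{n ∈ Ioc ⌊Y ^ 64⌋₊ ⌊2 * Y ^ 64⌋₊ |
        |((n : ℕ) : ℝ) ^ c - round ((n : ℝ) ^ c)| ≤ 1 / (6 * K)} : ℝ) ≤ C * Y ^ 64 / K := by
  obtain ⟨C, hC, Y₀, hY₀, hexp⟩ := exists_norm_sum_phase_rpow_le hc1 hc2 hc3
  refine ⟨4 * (2 + C), by positivity, Y₀, hY₀, ?_⟩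
  intro Y hY K hK hKY
  have hY0 : 0 < Y := by linarith
  have hK' : (0 : ℝ) < K := by exact_mod_cast hK
  set s := Ioc ⌊Y ^ 64⌋₊ ⌊2 * Y ^ 64⌋₊ with hs
  set t := {n ∈ s | |((n : ℕ) : ℝ) ^ c - round ((n : ℝ) ^ c)| ≤ 1 / (6 * K)} with ht
  have hsq := sum_norm_sum_sq_le (w := fun k n => phase (k * (n : ℝ) ^ c)) (s := s) (Q := K)
    (T := C * Y ^ 63) (by positivity) (fun _ _ => (norm_phase _).le) (by
      intro p q hpq hq
      have h1 := hexp Y hY (q - p) (by omega) (by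
        refine le_trans ?_ hKY
        exact_mod_cast (Nat.sub_le q p).trans hq.le)
      refine le_trans (le_of_eq ?_) h1
      congr 1
      refine Finset.sum_congr rfl fun n _ => ?_
      rw [phase_mul_conj, ← sub_mul, Nat.cast_sub hpq.le])
  have hlow : (#t : ℝ) * ((K : ℝ) / 2) ^ 2
      ≤ ∑ n ∈ s, ‖∑ k ∈ range K, phase (k * (n : ℝ) ^ c)‖ ^ 2 := by
    calc (#t : ℝ) * ((K : ℝ) / 2) ^ 2 = ∑ n ∈ t, ((K : ℝ) / 2) ^ 2 := by
          rw [Finset.sum_const, nsmul_eq_mul]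
      _ ≤ ∑ n ∈ t, ‖∑ k ∈ range K, phase (k * (n : ℝ) ^ c)‖ ^ 2 := by
          refine Finset.sum_le_sum fun n hn => ?_
          have := half_le_norm_sum_phase hK (Finset.mem_filter.1 hn).2
          gcongr
      _ ≤ _ := Finset.sum_le_sum_of_subset_of_nonneg (Finset.filter_subset _ _)
          fun _ _ _ => sq_nonneg _
  have hcard := card_Ioc_floor_le (X := Y ^ 64) (by positivity)
  rw [← hs] at hcard
  rw [le_div_iff₀ hK']
  have hfin : (#t : ℝ) * ((K : ℝ) / 2) ^ 2 ≤ K * (2 * Y ^ 64) + K * (Y * (C * Y ^ 63)) := by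
    refine (hlow.trans hsq).trans ?_
    rw [sq, mul_assoc (K : ℝ) K]
    gcongr
  refine le_of_mul_le_mul_left ?_ hK'
  linarith

lemma mfun_le_card {H θ : ℝ} (hH : 1 ≤ H) :
    mfun H θ ≤ 6 / H * (1 + #{K ∈ Icc 1 ⌊H⌋₊ | |θ - round θ| ≤ 1 / (6 * (K : ℕ))}) := by
  have hH0 : 0 < H := by linarith
  rw [mfun]
  set t := |θ - round θ| with ht
  have key : ∀ m : ℝ, 0 ≤ m → m ≤ H → (∀ K : ℕ, 0 < K → (K : ℝ) ≤ m → t ≤ 1 / (6 * K)) →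
      m ≤ 1 + #{K ∈ Icc 1 ⌊H⌋₊ | t ≤ 1 / (6 * (K : ℕ))} := by
    intro m hm0 hm h
    have hsub : Icc 1 ⌊m⌋₊ ⊆ {K ∈ Icc 1 ⌊H⌋₊ | t ≤ 1 / (6 * (K : ℕ))} := by
      intro K hK
      rw [Finset.mem_Icc] at hK
      rw [Finset.mem_filter, Finset.mem_Icc]
      exact ⟨⟨hK.1, hK.2.trans (Nat.floor_mono hm)⟩,
        h K hK.1 ((Nat.le_floor_iff hm0).1 hK.2)⟩
    have h1 := Finset.card_le_card hsub
    rw [Nat.card_Icc, Nat.add_sub_cancel] at h1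
    have h2 : (⌊m⌋₊ : ℝ) ≤ #{K ∈ Icc 1 ⌊H⌋₊ | t ≤ 1 / (6 * (K : ℕ))} := by exact_mod_cast h1
    linarith [Nat.lt_floor_add_one m]
  split_ifs with h0
  · have h1 := key H hH0.le le_rfl fun K hK _ => by rw [h0]; positivity
    rw [div_mul_eq_mul_div, le_div_iff₀ hH0]
    linarith
  · have ht0 : 0 < t := lt_of_le_of_ne (abs_nonneg _) (Ne.symm h0)
    have h1 := key (min H (1 / (6 * t))) (by positivity) (min_le_left _ _) fun K hK hKm => by
      have hK' : (0 : ℝ) < K := by exact_mod_cast hK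
      have h2 := hKm.trans (min_le_right _ _)
      rw [le_div_iff₀ (by positivity)] at h2 ⊢
      linarith
    refine le_trans ?_ (mul_le_mul_of_nonneg_left h1 (by positivity))
    rcases min_cases H (1 / (6 * t)) with ⟨h, _⟩ | ⟨h, _⟩ <;> rw [h]
    · refine (min_le_left _ _).trans ?_
      rw [div_mul_cancel₀ _ hH0.ne']
      norm_num
    · refine (min_le_right _ _).trans (le_of_eq ?_)
      field_simp

theorem stmt_12 (c : ℝ) (hc1 : 1 < c) (hc2 : c < 4109054 / 1999527) (hc3 : c ≠ 2) :
    ∃ C > 0, ∃ X₀ : ℝ, ∀ X : ℝ, X₀ ≤ X →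
      (∑ n ∈ Finset.Ioc ⌊X⌋₊ ⌊2 * X⌋₊, mfun (X ^ ((38687 : ℝ) / 2666036)) ((n : ℝ) ^ c))
        ≤ C * X ^ ((2627349 : ℝ) / 2666036) * Real.log X := by
  obtain ⟨C, hC, Y₀, hY₀, hcount⟩ :=
    exists_card_near_integer_le hc1 (hc2.trans (by norm_num)) hc3
  refine ⟨6 * (2 + 2 * C), by positivity, max (Y₀ ^ 64) (exp 1), ?_⟩
  intro X hX
  have hXe : exp 1 ≤ X := (le_max_right _ _).trans hX
  have hX0 : 0 < X := (exp_pos 1).trans_le hXe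
  have hlog : 1 ≤ log X := by rwa [Real.le_log_iff_exp_le hX0]
  have hX1 : 1 ≤ X := (Real.one_le_exp zero_le_one).trans hXe
  set H : ℝ := X ^ ((38687 : ℝ) / 2666036) with hH
  have hH1 : 1 ≤ H := Real.one_le_rpow hX1 (by norm_num)
  have hH0 : 0 < H := by linarith
  set Y : ℝ := X ^ ((1 : ℝ) / 64) with hY
  have hY64 : Y ^ 64 = X := by
    rw [hY, ← Real.rpow_natCast, ← Real.rpow_mul hX0.le]
    norm_num
  have hYY : Y₀ ≤ Y := by
    refine le_of_pow_le_pow_left₀ (n := 64) (by norm_num) (by positivity) ?_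
    rw [hY64]
    exact (le_max_left _ _).trans hX
  have hHY : H ≤ Y := Real.rpow_le_rpow_of_exponent_le hX1 (by norm_num)
  have hXH : X ^ ((2627349 : ℝ) / 2666036) = X / H := by
    rw [hH, show (2627349 : ℝ) / 2666036 = 1 - 38687 / 2666036 by norm_num,
      Real.rpow_sub hX0, Real.rpow_one]
  have hlogH : log H ≤ log X := by
    rw [hH, Real.log_rpow hX0]
    nlinarith
  set s := Ioc ⌊X⌋₊ ⌊2 * X⌋₊ with hs
  have hcard : (#s : ℝ) ≤ 2 * X := card_Ioc_floor_le hX0.le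
  have hharm : ∑ K ∈ Icc 1 ⌊H⌋₊, (1 : ℝ) / K ≤ 1 + log X := by
    have h1 := harmonic_floor_le_one_add_log H hH1
    rw [harmonic_eq_sum_Icc] at h1
    push_cast at h1
    simp only [one_div]
    linarith
  have hswap : ∑ n ∈ s, (#{K ∈ Icc 1 ⌊H⌋₊ |
        |(n : ℝ) ^ c - round ((n : ℝ) ^ c)| ≤ 1 / (6 * (K : ℕ))} : ℝ)
      = ∑ K ∈ Icc 1 ⌊H⌋₊, (#{n ∈ s |
        |((n : ℕ) : ℝ) ^ c - round ((n : ℝ) ^ c)| ≤ 1 / (6 * (K : ℕ))} : ℝ) := by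
    have h := Finset.sum_card_bipartiteAbove_eq_sum_card_bipartiteBelow
      (s := s) (t := Icc 1 ⌊H⌋₊)
      (fun (n K : ℕ) => |(n : ℝ) ^ c - round ((n : ℝ) ^ c)| ≤ 1 / (6 * (K : ℝ)))
    have h' := congrArg (Nat.cast : ℕ → ℝ) h
    rwa [Nat.cast_sum, Nat.cast_sum] at h'
  have hK : ∀ K ∈ Icc 1 ⌊H⌋₊, (#{n ∈ s |
      |((n : ℕ) : ℝ) ^ c - round ((n : ℝ) ^ c)| ≤ 1 / (6 * (K : ℕ))} : ℝ) ≤ C * X * (1 / K) := by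
    intro K hK
    rw [Finset.mem_Icc] at hK
    have h1 := hcount Y hYY K hK.1 (((Nat.le_floor_iff hH0.le).1 hK.2).trans hHY)
    rw [hY64] at h1
    rwa [mul_one_div]
  calc ∑ n ∈ s, mfun H ((n : ℝ) ^ c)
      ≤ ∑ n ∈ s, 6 / H * (1 + (#{K ∈ Icc 1 ⌊H⌋₊ |
        |(n : ℝ) ^ c - round ((n : ℝ) ^ c)| ≤ 1 / (6 * (K : ℕ))} : ℝ)) :=
        Finset.sum_le_sum fun n _ => mfun_le_card hH1
    _ = 6 / H * (#s + ∑ K ∈ Icc 1 ⌊H⌋₊, (#{n ∈ s |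
        |((n : ℕ) : ℝ) ^ c - round ((n : ℝ) ^ c)| ≤ 1 / (6 * (K : ℕ))} : ℝ)) := by
        rw [← Finset.mul_sum, Finset.sum_add_distrib, hswap]
        simp
    _ ≤ 6 / H * (2 * X + ∑ K ∈ Icc 1 ⌊H⌋₊, C * X * (1 / (K : ℝ))) := by
        gcongr with K hK'
        exact hK K hK'
    _ ≤ 6 / H * (2 * X + C * X * (1 + log X)) := by
        rw [← Finset.mul_sum]
        gcongr
    _ ≤ 6 / H * (2 * X * log X + C * X * (log X + log X)) := by
        have h2 : 2 * X ≤ 2 * X * log X := le_mul_of_one_le_right (by positivity) hlog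
        gcongr
    _ = 6 * (2 + 2 * C) * X ^ ((2627349 : ℝ) / 2666036) * Real.log X := by
        rw [hXH]
        ring
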